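/- For all real numbers t and r with 0 ≤ t < 1 and 0 ≤ r < 2−√3, one has t + r(1 − t²)/(1 − r)² < 1. -/

import Mathlib

theorem elementary_inequality_two_sub_sqrt_three
    (t r : ℝ) (ht0 : 0 ≤ t) (ht1 : t < 1) (hr0 : 0 ≤ r) (hr1 : r < 2 - Real.sqrt 3) :
    t + r * (1 - t ^ 2) / (1 - r) ^ 2 < 1 := by
  have hquad : 3 < (2 - r) ^ 2 := Real.lt_sq_of_sqrt_lt (by linarith)
  have hfactor : r * (1 + t) < (1 - r) ^ 2 := by nlinarith
  have hpos : 0 < (1 - r) ^ 2 := lt_of_le_of_lt (by positivity) hfactor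
  rw [← lt_sub_iff_add_lt', div_lt_iff₀ hpos]
  calc r * (1 - t ^ 2) = (1 - t) * (r * (1 + t)) := by ring
    _ < (1 - t) * (1 - r) ^ 2 := mul_lt_mul_of_pos_left hfactor (sub_pos.mpr ht1)
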